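/- Let p and q be coprime integers with p > q > 1 and p > 2q−1. For every n ∈ ℕ there exist two ω-words w and v, each labelling a branch of the automaton S_{p/q} from n, such that ρ(w) ≠ ρ(v). -/

import Mathlib

/-- `w` labels a branch of the base-p/q automaton with digit set `E` from state `n`:
there are states `s 0 = n, s 1, s 2, …` with `q·s(k+1) = p·s k + w k` and `w k ∈ E`. -/
def IsBranch (p q : ℕ) (E : Set ℤ) (n : ℕ) (w : ℕ → ℤ) : Prop :=
  ∃ s : ℕ → ℕ, s 0 = n ∧ ∀ k : ℕ, (q : ℤ) * s (k + 1) = p * s k + w k ∧ w k ∈ E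

/-- `u` (a word of length `ℓ`) labels a path from `n` to `m` in the base-p/q automaton
with digit set `E`. -/
def IsPath (p q : ℕ) (E : Set ℤ) (n m ℓ : ℕ) (u : ℕ → ℤ) : Prop :=
  ∃ s : ℕ → ℕ, s 0 = n ∧ s ℓ = m ∧
    ∀ k < ℓ, (q : ℤ) * s (k + 1) = p * s k + u k ∧ u k ∈ E

/-- The canonical digit alphabet `A_p = {0, 1, …, p−1}`. -/
def Ap (p : ℕ) : Set ℤ := Set.Icc 0 ((p : ℤ) - 1)

/-- The lower alphabet `{0, 1, …, q−1}`. -/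
def LowAlph (q : ℕ) : Set ℤ := Set.Icc 0 ((q : ℤ) - 1)

/-- The upper alphabet `{p−q, …, p−1}`. -/
def UpAlph (p q : ℕ) : Set ℤ := Set.Icc ((p : ℤ) - q) ((p : ℤ) - 1)

/-- The alphabet `D = {p−2q+1, …, p−1}` of the automaton `S_{p/q}`. -/
def Dalph (p q : ℕ) : Set ℤ := Set.Icc ((p : ℤ) - 2 * q + 1) ((p : ℤ) - 1)

/-- Evaluation after the radix point: `ρ(w) = Σ_{i≥1} (w_i/q)·(q/p)^i`
(here `w k` is the `(k+1)`-st digit). -/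
noncomputable def rho (p q : ℕ) (w : ℕ → ℤ) : ℝ :=
  ∑' i : ℕ, ((w i : ℝ) / q) * ((q : ℝ) / p) ^ (i + 1)

theorem IsBranch.mono {p q : ℕ} {E F : Set ℤ} {n : ℕ} {w : ℕ → ℤ} (hEF : E ⊆ F)
    (h : IsBranch p q E n w) : IsBranch p q F n w := by
  obtain ⟨s, h0, hs⟩ := h
  exact ⟨s, h0, fun k => ⟨(hs k).1, hEF (hs k).2⟩⟩

/-- A complete residue system of nonnegative digits admits a branch from every state. -/
theorem exists_isBranch_Icc (p : ℕ) {q : ℕ} (hq : 0 < q) {a : ℤ} (ha : 0 ≤ a) (n : ℕ) :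
    ∃ w, IsBranch p q (Set.Icc a (a + q - 1)) n w := by
  have step (m : ℕ) : ∃ (m' : ℕ) (d : ℤ),
      (q : ℤ) * m' = p * m + d ∧ d ∈ Set.Icc a (a + q - 1) := by
    have hq' : (0 : ℤ) < q := by exact_mod_cast hq
    have hr := Int.emod_nonneg (-(p * m + a)) hq'.ne'
    have hr' := Int.emod_lt_of_pos (-(p * m + a)) hq'
    have hdiv := Int.mul_ediv_add_emod (-(p * m + a)) q
    have hm : (0 : ℤ) ≤ -((-(p * m + a)) / q) := by
      have hpm : (0 : ℤ) ≤ p * m := by positivity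
      by_contra! h
      nlinarith
    refine ⟨(-((-(p * m + a)) / q : ℤ)).toNat, a + (-(p * m + a)) % q, ?_, by omega, by omega⟩
    rw [Int.toNat_of_nonneg hm]
    linarith
  choose f g hfg hg using step
  refine ⟨fun k => g (f^[k] n), fun k => f^[k] n, rfl, fun k => ⟨?_, hg _⟩⟩
  simp only [Function.iterate_succ_apply']
  exact hfg _

/-- The constant word `p - q` labels no branch, since `q ^ k` would divide `n + 1` for all `k`. -/
theorem not_isBranch_const {p q : ℕ} (hco : Nat.Coprime p q) (hq : 1 < q) (E : Set ℤ) (n : ℕ) :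
    ¬ IsBranch p q E n (fun _ => (p : ℤ) - q) := by
  rintro ⟨s, h0, hs⟩
  have hstep (k : ℕ) : q * (s (k + 1) + 1) = p * (s k + 1) := by
    have := (hs k).1
    zify
    linarith
  have hpow (k : ℕ) : q ^ k * (s k + 1) = p ^ k * (n + 1) := by
    induction k with
    | zero => simp [h0]
    | succ k ih =>
      calc q ^ (k + 1) * (s (k + 1) + 1) = q ^ k * (q * (s (k + 1) + 1)) := by ring
        _ = p * (q ^ k * (s k + 1)) := by rw [hstep]; ring
        _ = p ^ (k + 1) * (n + 1) := by rw [ih]; ring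
  have hdvd : q ^ (n + 1) ∣ n + 1 :=
    (hco.symm.pow (n + 1) (n + 1)).dvd_of_dvd_mul_left ⟨_, (hpow (n + 1)).symm⟩
  exact (Nat.le_of_dvd n.succ_pos hdvd).not_gt (Nat.lt_pow_self hq)

theorem summable_rho {p q : ℕ} (hpq : q < p) {w : ℕ → ℤ} {a b : ℤ}
    (hw : ∀ k, w k ∈ Set.Icc a b) :
    Summable fun i : ℕ => ((w i : ℝ) / q) * ((q : ℝ) / p) ^ (i + 1) := by
  have hr : (q : ℝ) / p < 1 := by
    rw [div_lt_one (by exact_mod_cast (Nat.zero_le q).trans_lt hpq)]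
    exact_mod_cast hpq
  have hgeom : Summable fun i : ℕ => ((q : ℝ) / p) ^ (i + 1) :=
    (summable_nat_add_iff 1).2 (summable_geometric_of_lt_one (by positivity) hr)
  refine Summable.of_norm_bounded (hgeom.mul_left (((max |a| |b| : ℤ) : ℝ) / q)) fun i => ?_
  have hle : |(w i : ℝ)| ≤ ((max |a| |b| : ℤ) : ℝ) := by
    exact_mod_cast abs_le_max_abs_abs (hw i).1 (hw i).2
  rw [Real.norm_eq_abs, abs_mul, abs_div, abs_of_nonneg (by positivity : (0 : ℝ) ≤ q),
    abs_of_nonneg (by positivity : (0 : ℝ) ≤ ((q : ℝ) / p) ^ (i + 1))]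
  gcongr

theorem rho_lt_rho {p q : ℕ} (hq : 0 < q) (hpq : q < p) {w v : ℕ → ℤ} {a b c d : ℤ}
    (hw : ∀ k, w k ∈ Set.Icc a b) (hv : ∀ k, v k ∈ Set.Icc c d)
    (hle : ∀ k, w k ≤ v k) {k : ℕ} (hk : w k < v k) : rho p q w < rho p q v := by
  have hq' : (0 : ℝ) < q := by exact_mod_cast hq
  have hp' : (0 : ℝ) < p := by exact_mod_cast hq.trans hpq
  refine Summable.tsum_lt_tsum (i := k) (fun i => ?_) ?_
    (summable_rho hpq hw) (summable_rho hpq hv)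
  · have : (w i : ℝ) ≤ v i := by exact_mod_cast hle i
    dsimp only
    gcongr
  · have : (w k : ℝ) < v k := by exact_mod_cast hk
    gcongr

theorem stmt16 (p q : ℕ) (hco : Nat.Coprime p q) (hq : 1 < q) (hpq : q < p)
    (hbig : 2 * q - 1 < p) :
    ∀ n : ℕ, ∃ w v : ℕ → ℤ,
      IsBranch p q (Dalph p q) n w ∧ IsBranch p q (Dalph p q) n v ∧
      rho p q w ≠ rho p q v := by
  intro n
  obtain ⟨w, hw⟩ := exists_isBranch_Icc p (zero_lt_one.trans hq)
    (a := (p : ℤ) - 2 * q + 1) (by omega) n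
  obtain ⟨v, hv⟩ := exists_isBranch_Icc p (zero_lt_one.trans hq)
    (a := (p : ℤ) - q) (by omega) n
  have hwE (k : ℕ) := hw.choose_spec.2 k |>.2
  have hvE (k : ℕ) := hv.choose_spec.2 k |>.2
  have hwle (k : ℕ) : w k ≤ p - q := by linarith [(hwE k).2]
  have hvge (k : ℕ) : (p : ℤ) - q ≤ v k := (hvE k).1
  refine ⟨w, v, hw.mono (Set.Icc_subset_Icc (by omega) (by omega)),
    hv.mono (Set.Icc_subset_Icc (by omega) (by omega)), ?_⟩
  obtain ⟨k, hk⟩ : ∃ k, w k < v k := by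
    by_contra! h
    have hconst : w = fun _ => (p : ℤ) - q :=
      funext fun k => (hwle k).antisymm ((hvge k).trans (h k))
    exact not_isBranch_const hco hq _ n (hconst ▸ hw)
  exact (rho_lt_rho (zero_lt_one.trans hq) hpq hwE hvE
    (fun k => (hwle k).trans (hvge k)) hk).ne
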